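/- Let g = ⊕_{j∈ℤ} g_j be a ℤ-graded Lie algebra of depth q and height r satisfying conditions (1.6), and suppose q ≤ r. Then ⁅g_{-q}, ⁅g_{-q}, g_q⁆⁆ ≠ 0; that is, there exist y, y' ∈ g_{-q} and z ∈ g_q with ⁅y', ⁅y, z⁆⁆ ≠ 0. -/

import Mathlib

/-- The sum of the negative homogeneous components of a graded Lie algebra. -/
def negPart {F L : Type*} [Field F] [LieRing L] [LieAlgebra F L]
    (g : ℤ → Submodule F L) : Submodule F L :=
  ⨆ j < (0 : ℤ), g j

/-- The sum of the nonnegative homogeneous components of a graded Lie algebra. -/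
def nonnegPart {F L : Type*} [Field F] [LieRing L] [LieAlgebra F L]
    (g : ℤ → Submodule F L) : Submodule F L :=
  ⨆ j ≥ (0 : ℤ), g j

/-- The linear span of all brackets `⁅x, y⁆` with `x ∈ A`, `y ∈ B`. -/
def bracketSpan {F L : Type*} [Field F] [LieRing L] [LieAlgebra F L]
    (A B : Submodule F L) : Submodule F L :=
  Submodule.span F {z : L | ∃ x ∈ A, ∃ y ∈ B, z = ⁅x, y⁆}

section GradedLie

variable {F L : Type*} [Field F] [LieRing L] [LieAlgebra F L]

/-- A family of homogeneous subspaces of a graded Lie algebra whose sum is a graded ideal. -/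
structure IsGradedIdeal (g P : ℤ → Submodule F L) : Prop where
  le : ∀ j, P j ≤ g j
  lie_mem : ∀ i j, ∀ x ∈ g i, ∀ y ∈ P j, ⁅x, y⁆ ∈ P (i + j)

/-- The homogeneous elements obtained from a subspace `N` of degree `k` by iterated brackets with
homogeneous elements whose degrees satisfy `D`, together with their sums in each degree. -/
inductive IsGenerated (g : ℤ → Submodule F L) (D : ℤ → Prop) (k : ℤ) (N : Submodule F L) :
    ℤ → L → Prop
  | base (x : L) (hx : x ∈ N) : IsGenerated g D k N k x
  | zero (j : ℤ) : IsGenerated g D k N j 0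
  | add (j : ℤ) (x y : L) (hx : IsGenerated g D k N j x) (hy : IsGenerated g D k N j y) :
      IsGenerated g D k N j (x + y)
  | smul (j : ℤ) (c : F) (x : L) (hx : IsGenerated g D k N j x) : IsGenerated g D k N j (c • x)
  | lie (i j : ℤ) (hi : D i) (a x : L) (ha : a ∈ g i) (hx : IsGenerated g D k N j x) :
      IsGenerated g D k N (i + j) ⁅a, x⁆

/-- The subspace of generated elements in a given degree. -/
def generatedPart (g : ℤ → Submodule F L) (D : ℤ → Prop) (k : ℤ) (N : Submodule F L) (j : ℤ) :
    Submodule F L where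
  carrier := {x | IsGenerated g D k N j x}
  zero_mem' := .zero j
  add_mem' hx hy := .add j _ _ hx hy
  smul_mem' c _ hx := .smul j c _ hx

variable {g : ℤ → Submodule F L}

/-- If brackets of `N` with elements of the remaining degrees are generated, then the generated
subspaces form a graded ideal. -/
theorem isGradedIdeal_generatedPart
    (hgraded : ∀ i j : ℤ, ∀ x ∈ g i, ∀ y ∈ g j, ⁅x, y⁆ ∈ g (i + j))
    {D : ℤ → Prop} {k : ℤ} {N : Submodule F L} (hN : N ≤ g k)
    (hbase : ∀ i, ¬ D i → ∀ a ∈ g i, ∀ x ∈ N, IsGenerated g D k N (i + k) ⁅a, x⁆) :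
    IsGradedIdeal g (generatedPart g D k N) where
  le j x hx := by
    change IsGenerated g D k N j x at hx
    induction hx with
    | base x hx => exact hN hx
    | zero j => exact zero_mem _
    | add j x y _ _ hx hy => exact add_mem hx hy
    | smul j c x _ hx => exact Submodule.smul_mem _ _ hx
    | lie i j _ a x ha _ hx => exact hgraded i j a ha x hx
  lie_mem i j a ha x hx := by
    change IsGenerated g D k N j x at hx
    change IsGenerated g D k N (i + j) ⁅a, x⁆
    by_cases hi : D i
    · exact .lie i j hi a x ha hx
    induction hx generalizing i a with
    | base x hx => exact hbase i hi a ha x hx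
    | zero j => simpa using IsGenerated.zero (i + j)
    | add j x y _ _ hx hy => rw [lie_add]; exact .add _ _ _ (hx i a ha hi) (hy i a ha hi)
    | smul j c x _ hx => rw [lie_smul]; exact .smul _ _ _ (hx i a ha hi)
    | lie l j hl b x hb hx ih =>
      rw [leibniz_lie]
      refine .add _ _ _ ?_ ?_
      · rw [← add_assoc]
        have hab := hgraded i l a ha b hb
        by_cases hil : D (i + l)
        · exact .lie _ _ hil _ _ hab hx
        · exact ih _ _ hab hil
      · rw [add_left_comm]
        exact .lie _ _ hl _ _ hb (ih i a ha hi)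

/-- A nonzero graded ideal has a nonzero component of nonnegative degree. -/
theorem IsGradedIdeal.exists_nonneg
    (htop : iSup g = ⊤)
    (hrad : ∀ J : Submodule F L, (∀ x : L, ∀ y ∈ J, ⁅x, y⁆ ∈ J) →
      J ≤ negPart g → J = ⊥)
    {P : ℤ → Submodule F L} (hP : IsGradedIdeal g P) {k : ℤ} (hk : P k ≠ ⊥) :
    ∃ j ≥ 0, P j ≠ ⊥ := by
  by_contra! h
  refine hk (le_bot_iff.mp ((le_iSup P k).trans (hrad (iSup P) ?_ ?_).le))
  · intro x y hy
    have hx : x ∈ iSup g := htop ▸ Submodule.mem_top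
    induction hx using Submodule.iSup_induction' with
    | zero => simp
    | add a b _ _ ha hb => rw [add_lie]; exact add_mem ha hb
    | mem i a ha =>
      induction hy using Submodule.iSup_induction' with
      | zero => simp
      | add u v _ _ hu hv => rw [lie_add]; exact add_mem hu hv
      | mem j u hu => exact Submodule.mem_iSup_of_mem _ (hP.lie_mem i j a ha u hu)
  · refine iSup_le fun j => ?_
    rcases lt_or_ge j 0 with hj | hj
    · exact (hP.le j).trans (le_iSup₂_of_le j hj le_rfl)
    · simp [h j hj]

theorem mem_nonnegPart {j : ℤ} (hj : 0 ≤ j) {x : L} (hx : x ∈ g j) : x ∈ nonnegPart g :=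
  (le_iSup₂_of_le (f := fun j (_ : j ≥ (0 : ℤ)) => g j) j hj le_rfl) hx

/-- A nonzero graded ideal of an irreducible transitive graded Lie algebra with vanishing
Weisfeiler radical contains the component of degree `-1`. -/
theorem IsGradedIdeal.neg_one_eq
    (htop : iSup g = ⊤)
    (hrad : ∀ J : Submodule F L, (∀ x : L, ∀ y ∈ J, ⁅x, y⁆ ∈ J) →
      J ≤ negPart g → J = ⊥)
    (hirr : ∀ W : Submodule F L, W ≤ g (-1) →
      (∀ x ∈ g 0, ∀ w ∈ W, ⁅x, w⁆ ∈ W) → W = ⊥ ∨ W = g (-1))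
    (htrans : ∀ x ∈ nonnegPart g, (∀ y ∈ g (-1), ⁅x, y⁆ = 0) → x = 0)
    {P : ℤ → Submodule F L} (hP : IsGradedIdeal g P) {k : ℤ} (hk : P k ≠ ⊥) :
    P (-1) = g (-1) := by
  obtain ⟨j, hj, hPj⟩ := hP.exists_nonneg htop hrad hk
  have descend : ∀ j : ℤ, -1 ≤ j → P j ≠ ⊥ → P (-1) ≠ ⊥ := by
    intro j hj
    induction j, hj using Int.leInduction with
    | base => exact id
    | succ j hj ih =>
      intro h
      refine ih fun hbot => h ((Submodule.eq_bot_iff _).mpr fun x hx => ?_)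
      refine htrans x (mem_nonnegPart (by omega) (hP.le _ hx)) fun w hw => ?_
      have hwx := hP.lie_mem (-1) (j + 1) w hw x hx
      rw [show -1 + (j + 1) = j by ring, hbot, Submodule.mem_bot] at hwx
      rw [← lie_skew, hwx, neg_zero]
  refine (hirr _ (hP.le _) fun x hx w hw => ?_).resolve_left (descend j (by omega) hPj)
  simpa using hP.lie_mem 0 (-1) x hx w hw

/-- If in addition the negative part is generated in degree `-1`, then a nonzero graded ideal
contains every component of negative degree. -/
theorem IsGradedIdeal.neg_eq
    (htop : iSup g = ⊤)
    (hrad : ∀ J : Submodule F L, (∀ x : L, ∀ y ∈ J, ⁅x, y⁆ ∈ J) →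
      J ≤ negPart g → J = ⊥)
    (hirr : ∀ W : Submodule F L, W ≤ g (-1) →
      (∀ x ∈ g 0, ∀ w ∈ W, ⁅x, w⁆ ∈ W) → W = ⊥ ∨ W = g (-1))
    (htrans : ∀ x ∈ nonnegPart g, (∀ y ∈ g (-1), ⁅x, y⁆ = 0) → x = 0)
    (hgen : ∀ i : ℤ, 2 ≤ i → g (-i) = bracketSpan (g (-1)) (g (-(i - 1))))
    {P : ℤ → Submodule F L} (hP : IsGradedIdeal g P) {k : ℤ} (hk : P k ≠ ⊥)
    {i : ℤ} (hi : 1 ≤ i) : P (-i) = g (-i) := by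
  induction i, hi using Int.leInduction with
  | base => exact hP.neg_one_eq htop hrad hirr htrans hk
  | succ i hi ih =>
    refine le_antisymm (hP.le _) ?_
    rw [hgen (i + 1) (by omega), add_sub_cancel_right]
    refine Submodule.span_le.mpr ?_
    rintro _ ⟨x, hx, y, hy, rfl⟩
    rw [← ih] at hy
    have := hP.lie_mem _ _ x hx y hy
    rwa [show -1 + -i = -(i + 1) by ring] at this

/-- An element commuting with `g (-1)` commutes with all components of negative degree. -/
theorem lie_eq_zero_of_neg
    (hgen : ∀ i : ℤ, 2 ≤ i → g (-i) = bracketSpan (g (-1)) (g (-(i - 1))))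
    {x : L} (hx : ∀ y ∈ g (-1), ⁅x, y⁆ = 0) {i : ℤ} (hi : 1 ≤ i) :
    ∀ y ∈ g (-i), ⁅x, y⁆ = 0 := by
  induction i, hi using Int.leInduction with
  | base => exact hx
  | succ i hi ih =>
    intro y hy
    rw [hgen (i + 1) (by omega), add_sub_cancel_right] at hy
    induction hy using Submodule.span_induction with
    | mem z hz =>
      obtain ⟨a, ha, b, hb, rfl⟩ := hz
      rw [leibniz_lie, hx a ha, ih b hb, zero_lie, lie_zero, add_zero]
    | zero => simp
    | add a b _ _ ha hb => rw [lie_add, ha, hb, add_zero]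
    | smul c a _ ha => rw [lie_smul, ha, smul_zero]

/-- Transitivity extends to all degrees above the lowest one. -/
theorem eq_zero_of_lie_neg_one_eq_zero
    (htop : iSup g = ⊤)
    (hgraded : ∀ i j : ℤ, ∀ x ∈ g i, ∀ y ∈ g j, ⁅x, y⁆ ∈ g (i + j))
    (hrad : ∀ J : Submodule F L, (∀ x : L, ∀ y ∈ J, ⁅x, y⁆ ∈ J) →
      J ≤ negPart g → J = ⊥)
    (hirr : ∀ W : Submodule F L, W ≤ g (-1) →
      (∀ x ∈ g 0, ∀ w ∈ W, ⁅x, w⁆ ∈ W) → W = ⊥ ∨ W = g (-1))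
    (htrans : ∀ x ∈ nonnegPart g, (∀ y ∈ g (-1), ⁅x, y⁆ = 0) → x = 0)
    (hgen : ∀ i : ℤ, 2 ≤ i → g (-i) = bracketSpan (g (-1)) (g (-(i - 1))))
    {q : ℤ} (hq : 1 ≤ q) (hdepth_ne : g (-q) ≠ ⊥)
    {k : ℤ} (hk : -q < k) {x : L} (hx : x ∈ g k) (hx1 : ∀ y ∈ g (-1), ⁅x, y⁆ = 0) : x = 0 := by
  let N : Submodule F L :=
    { carrier := {x | x ∈ g k ∧ ∀ y ∈ g (-1), ⁅x, y⁆ = 0}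
      zero_mem' := ⟨zero_mem _, fun y _ => zero_lie y⟩
      add_mem' := fun {a b} ha hb => ⟨add_mem ha.1 hb.1, fun y hy => by
        rw [add_lie, ha.2 y hy, hb.2 y hy, add_zero]⟩
      smul_mem' := fun c a ha => ⟨Submodule.smul_mem _ _ ha.1, fun y hy => by
        rw [smul_lie, ha.2 y hy, smul_zero]⟩ }
  have hP : IsGradedIdeal g (generatedPart g (0 < ·) k N) := by
    refine isGradedIdeal_generatedPart hgraded (fun y hy => hy.1) fun i hi a ha y hy => ?_
    rcases lt_or_eq_of_le (not_lt.mp hi) with hi | rfl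
    · have := lie_eq_zero_of_neg hgen hy.2 (i := -i) (by omega) a (by rwa [neg_neg])
      rw [← lie_skew, this, neg_zero]
      exact .zero _
    · rw [zero_add]
      refine .base _ ⟨by simpa using hgraded 0 k a ha y hy.1, fun w hw => ?_⟩
      rw [lie_lie, hy.2 w hw, lie_zero, zero_sub,
        hy.2 _ (by simpa using hgraded 0 (-1) a ha w hw), neg_zero]
  by_contra hx0
  have hPk : generatedPart g (0 < ·) k N k ≠ ⊥ :=
    (Submodule.ne_bot_iff _).mpr ⟨x, .base x ⟨hx, hx1⟩, hx0⟩
  have hlow : ∀ j y, IsGenerated g (0 < ·) k N j y → j < k → y = 0 := by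
    intro j y hy
    induction hy with
    | base x hx => exact fun h => (lt_irrefl _ h).elim
    | zero j => exact fun _ => rfl
    | add j x y _ _ hx hy => exact fun h => by rw [hx h, hy h, add_zero]
    | smul j c x _ hx => exact fun h => by rw [hx h, smul_zero]
    | lie i j hi a x ha _ hx => exact fun h => by rw [hx (by omega), lie_zero]
  refine hdepth_ne ((Submodule.eq_bot_iff _).mpr fun y hy => ?_)
  rw [← hP.neg_eq htop hrad hirr htrans hgen hPk hq] at hy
  exact hlow _ y hy hk

/-- If `g (-q)` is the lowest component and `⁅g (-q), ⁅g (-q), g q⁆⁆ = 0`, then all brackets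
`⁅g (-q), ⁅g (-q), g j⁆⁆` vanish. -/
theorem lie_lie_eq_zero_of_lowest
    (hgraded : ∀ i j : ℤ, ∀ x ∈ g i, ∀ y ∈ g j, ⁅x, y⁆ ∈ g (i + j))
    {q : ℤ} (hdepth : ∀ j : ℤ, q < j → g (-j) = ⊥)
    (hext : ∀ k : ℤ, -q < k → ∀ x ∈ g k, (∀ y ∈ g (-1), ⁅x, y⁆ = 0) → x = 0)
    (h : ∀ y ∈ g (-q), ∀ y' ∈ g (-q), ∀ z ∈ g q, ⁅y', ⁅y, z⁆⁆ = 0)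
    (j : ℤ) : ∀ y ∈ g (-q), ∀ y' ∈ g (-q), ∀ z ∈ g j, ⁅y', ⁅y, z⁆⁆ = 0 := by
  have hcomm : ∀ y ∈ g (-q), ∀ w ∈ g (-1), ⁅y, w⁆ = 0 := fun y hy w hw => by
    have := hgraded _ _ y hy w hw
    rwa [show -q + -1 = -(q + 1) by ring, hdepth _ (by omega), Submodule.mem_bot] at this
  have hdeg : ∀ j, ∀ y ∈ g (-q), ∀ y' ∈ g (-q), ∀ z ∈ g j, ⁅y', ⁅y, z⁆⁆ ∈ g (-(q + (q - j))) :=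
    fun j y hy y' hy' z hz => by
      have := hgraded _ _ y' hy' _ (hgraded _ _ y hy z hz)
      rwa [show -q + (-q + j) = -(q + (q - j)) by ring] at this
  rcases lt_or_ge j q with hj | hj
  · intro y hy y' hy' z hz
    have := hdeg j y hy y' hy' z hz
    rwa [hdepth _ (by omega), Submodule.mem_bot] at this
  induction j, hj using Int.leInduction with
  | base => exact h
  | succ j hj ih =>
    intro y hy y' hy' z hz
    refine hext _ (by omega) _ (hdeg _ y hy y' hy' z hz) fun w hw => ?_
    have hzw : ⁅z, w⁆ ∈ g j := by
      have := hgraded _ _ z hz w hw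
      rwa [add_neg_cancel_right] at this
    rw [lie_lie, hcomm y' hy' w hw, lie_zero, sub_zero, lie_lie, hcomm y hy w hw, lie_zero,
      sub_zero, ih y hy y' hy' _ hzw]

/-- The sandwich identity: brackets `⁅y, ⁅x, ⁅y', v⁆⁆⁆` are skew-symmetric in `y` and `y'`
when double brackets with `y`, `y'` vanish. -/
theorem sandwich_skew {y y' x v : L} (hx : ⁅y, ⁅y', x⁆⁆ = 0) (hv : ⁅y', ⁅y, v⁆⁆ = 0)
    (hxv : ⁅y, ⁅y', ⁅x, v⁆⁆⁆ = 0) : ⁅y, ⁅x, ⁅y', v⁆⁆⁆ = -⁅y', ⁅x, ⁅y, v⁆⁆⁆ := by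
  have h : ⁅⁅y, ⁅y', x⁆⁆, v⁆ = 0 := by rw [hx, zero_lie]
  rw [lie_lie, lie_lie, lie_lie, lie_sub, hxv, hv, lie_zero, zero_sub, sub_zero, sub_eq_zero] at h
  rw [← h, neg_neg]

/-- If double brackets with elements of `Y` vanish, then some nonzero vector of a nonzero
subspace `V` stable under all `⁅y, ⁅x, ·⁆⁆` is killed by all of them. -/
theorem exists_ne_zero_killed [FiniteDimensional F L] (hchar2 : ringChar F ≠ 2)
    {X Y V : Submodule F L} (hV : V ≠ ⊥)
    (hstable : ∀ y ∈ Y, ∀ x ∈ X, ∀ w ∈ V, ⁅y, ⁅x, w⁆⁆ ∈ V)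
    (hskew : ∀ y ∈ Y, ∀ y' ∈ Y, ∀ x ∈ X, ∀ x' ∈ X, ∀ w ∈ V,
      ⁅y, ⁅x, ⁅y', ⁅x', w⁆⁆⁆⁆ = -⁅y', ⁅x, ⁅y, ⁅x', w⁆⁆⁆⁆) :
    ∃ w ∈ V, w ≠ 0 ∧ ∀ y ∈ Y, ∀ x ∈ X, ⁅y, ⁅x, w⁆⁆ = 0 := by
  let S : Set (Submodule F L) :=
    {Z | Z ≤ Y ∧ ∃ w ∈ V, w ≠ 0 ∧ ∀ y ∈ Z, ∀ x ∈ X, ⁅y, ⁅x, w⁆⁆ = 0}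
  have hS : S.Nonempty := by
    obtain ⟨w, hw, hw0⟩ := (Submodule.ne_bot_iff _).mp hV
    exact ⟨⊥, bot_le, w, hw, hw0, fun y hy x _ => by rw [(Submodule.mem_bot F).mp hy, zero_lie]⟩
  obtain ⟨Z, ⟨hZY, w, hw, hw0, hwZ⟩, hmax⟩ := wellFounded_gt.has_min S hS
  suffices hZ : Y ≤ Z from ⟨w, hw, hw0, fun y hy => hwZ y (hZ hy)⟩
  intro y hy
  have extend : ∀ v ∈ V, v ≠ 0 → (∀ z ∈ Z, ∀ x ∈ X, ⁅z, ⁅x, v⁆⁆ = 0) →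
      (∀ x ∈ X, ⁅y, ⁅x, v⁆⁆ = 0) → y ∈ Z := by
    intro v hv hv0 hvZ hvy
    by_contra hyZ
    refine hmax (Z ⊔ F ∙ y) ⟨sup_le hZY (by simpa using hy), v, hv, hv0, ?_⟩
      (lt_of_le_of_ne le_sup_left fun h => hyZ ?_)
    · intro u hu x hx
      obtain ⟨z, hz, u', hu', rfl⟩ := Submodule.mem_sup.mp hu
      obtain ⟨c, rfl⟩ := Submodule.mem_span_singleton.mp hu'
      rw [add_lie, smul_lie, hvZ z hz x hx, hvy x hx, smul_zero, add_zero]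
    · rw [h]
      exact Submodule.mem_sup_right (Submodule.mem_span_singleton_self y)
  by_cases hall : ∀ x ∈ X, ⁅y, ⁅x, w⁆⁆ = 0
  · exact extend w hw hw0 hwZ hall
  push Not at hall
  obtain ⟨x, hx, hne⟩ := hall
  refine extend _ (hstable y hy x hx w hw) hne (fun z hz x' hx' => ?_) fun x' hx' => ?_
  · rw [hskew z (hZY hz) y hy x' hx' x hx w hw, hwZ z hz x hx, lie_zero, lie_zero, neg_zero]
  · have h := hskew y hy y hy x' hx' x hx w hw
    rw [eq_neg_iff_add_eq_zero, ← two_smul F] at h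
    exact (smul_eq_zero.mp h).resolve_left (Ring.two_ne_zero hchar2)

/-- If `⁅g (-q), ⁅g (-q), g q⁆⁆ = 0`, then already `⁅g (-q), g q⁆ = 0`. -/
theorem lie_eq_zero_of_lie_lie_eq_zero [FiniteDimensional F L] (hchar2 : ringChar F ≠ 2)
    (hgraded : ∀ i j : ℤ, ∀ x ∈ g i, ∀ y ∈ g j, ⁅x, y⁆ ∈ g (i + j))
    {q : ℤ} (hdepth : ∀ j : ℤ, q < j → g (-j) = ⊥)
    (hirr_ne : g (-1) ≠ ⊥)
    (hirr : ∀ W : Submodule F L, W ≤ g (-1) →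
      (∀ x ∈ g 0, ∀ w ∈ W, ⁅x, w⁆ ∈ W) → W = ⊥ ∨ W = g (-1))
    (htrans : ∀ x ∈ nonnegPart g, (∀ y ∈ g (-1), ⁅x, y⁆ = 0) → x = 0)
    (h : ∀ j, ∀ y ∈ g (-q), ∀ y' ∈ g (-q), ∀ z ∈ g j, ⁅y', ⁅y, z⁆⁆ = 0) :
    ∀ y ∈ g (-q), ∀ z ∈ g q, ⁅y, z⁆ = 0 := by
  obtain ⟨w₀, hw₀, hw₀_ne, hkill⟩ := exists_ne_zero_killed hchar2 (X := g q) (Y := g (-q)) hirr_ne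
    (fun y hy x hx w hw => by
      have := hgraded _ _ y hy _ (hgraded _ _ x hx w hw)
      rwa [neg_add_cancel_left] at this)
    (fun y hy y' hy' x hx x' hx' w hw => by
      have hv := hgraded _ _ x' hx' w hw
      exact sandwich_skew (h _ y' hy' y hy x hx) (h _ y hy y' hy' _ hv)
        (h _ y' hy' y hy _ (hgraded _ _ x hx _ hv)))
  let W : Submodule F L :=
    { carrier := {w | w ∈ g (-1) ∧ ∀ y ∈ g (-q), ∀ x ∈ g q, ⁅y, ⁅x, w⁆⁆ = 0}
      zero_mem' := ⟨zero_mem _, fun y _ x _ => by rw [lie_zero, lie_zero]⟩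
      add_mem' := fun {a b} ha hb => ⟨add_mem ha.1 hb.1, fun y hy x hx => by
        rw [lie_add, lie_add, ha.2 y hy x hx, hb.2 y hy x hx, add_zero]⟩
      smul_mem' := fun c a ha => ⟨Submodule.smul_mem _ _ ha.1, fun y hy x hx => by
        rw [lie_smul, lie_smul, ha.2 y hy x hx, smul_zero]⟩ }
  have hW : W = g (-1) := by
    refine (hirr W (fun w hw => hw.1) fun a ha w hw => ⟨?_, fun y hy x hx => ?_⟩).resolve_left
      ((Submodule.ne_bot_iff _).mpr ⟨w₀, ⟨hw₀, hkill⟩, hw₀_ne⟩)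
    · simpa using hgraded 0 (-1) a ha w hw.1
    · have hxa : ⁅x, a⁆ ∈ g q := by simpa using hgraded _ _ x hx a ha
      have hya : ⁅y, a⁆ ∈ g (-q) := by simpa using hgraded _ _ y hy a ha
      rw [leibniz_lie x a w, lie_add, hw.2 y hy _ hxa, leibniz_lie y a, hw.2 _ hya x hx,
        hw.2 y hy x hx, lie_zero, add_zero, add_zero]
  intro y hy z hz
  refine htrans _ (mem_nonnegPart le_rfl (by simpa using hgraded _ _ y hy z hz)) fun w hw => ?_
  have hyw := hgraded _ _ y hy w hw
  rw [show -q + -1 = -(q + 1) by ring, hdepth _ (by omega), Submodule.mem_bot] at hyw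
  rw [lie_lie, hyw, lie_zero, sub_zero]
  rw [← hW] at hw
  exact hw.2 y hy z hz

/-- The lowest component does not commute with the component of opposite degree. -/
theorem exists_lie_ne_zero
    (htop : iSup g = ⊤)
    (hgraded : ∀ i j : ℤ, ∀ x ∈ g i, ∀ y ∈ g j, ⁅x, y⁆ ∈ g (i + j))
    {q r : ℤ}
    (hdepth_ne : g (-q) ≠ ⊥)
    (hdepth : ∀ j : ℤ, q < j → g (-j) = ⊥)
    (hheight_ne : g r ≠ ⊥)
    (hheight : ∀ j : ℤ, r < j → g j = ⊥)
    (hirr : ∀ W : Submodule F L, W ≤ g (-1) →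
      (∀ x ∈ g 0, ∀ w ∈ W, ⁅x, w⁆ ∈ W) → W = ⊥ ∨ W = g (-1))
    (htrans : ∀ x ∈ nonnegPart g, (∀ y ∈ g (-1), ⁅x, y⁆ = 0) → x = 0)
    (hrad : ∀ J : Submodule F L, (∀ x : L, ∀ y ∈ J, ⁅x, y⁆ ∈ J) →
      J ≤ negPart g → J = ⊥)
    (hqr : q ≤ r) :
    ∃ y ∈ g (-q), ∃ z ∈ g q, ⁅y, z⁆ ≠ 0 := by
  by_contra! h
  have hlow : ∀ i < 0, ∀ y ∈ g (-q), ∀ w ∈ g i, ⁅y, w⁆ = 0 := fun i hi y hy w hw => by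
    have := hgraded _ _ y hy w hw
    rwa [show -q + i = -(q - i) by ring, hdepth _ (by omega), Submodule.mem_bot] at this
  have hhigh : ∀ j, q ≤ j → ∀ y ∈ g (-q), ∀ z ∈ g j, ⁅y, z⁆ = 0 := by
    intro j hj
    induction j, hj using Int.leInduction with
    | base => exact h
    | succ j hj ih =>
      intro y hy z hz
      refine htrans _ (mem_nonnegPart (by omega) (hgraded _ _ y hy z hz)) fun w hw => ?_
      have hzw := hgraded _ _ z hz w hw
      rw [add_neg_cancel_right] at hzw
      rw [lie_lie, hlow _ (by omega) y hy w hw, lie_zero, sub_zero, ih y hy _ hzw]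
  let K := generatedPart g (· < 0) r (g r)
  have hK : IsGradedIdeal g K := by
    refine isGradedIdeal_generatedPart hgraded le_rfl fun i hi a ha x hx => ?_
    have hax := hgraded _ _ a ha x hx
    rcases lt_or_eq_of_le (not_lt.mp hi) with hi | rfl
    · rw [hheight _ (by omega), Submodule.mem_bot] at hax
      rw [hax]
      exact .zero _
    · rw [zero_add] at hax ⊢
      exact .base _ hax
  have hK1 : K (-1) = g (-1) := by
    obtain ⟨x, hx, hx0⟩ := (Submodule.ne_bot_iff _).mp hheight_ne
    exact hK.neg_one_eq htop hrad hirr htrans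
      ((Submodule.ne_bot_iff _).mpr ⟨x, IsGenerated.base x hx, hx0⟩)
  have hcomm : ∀ j z, IsGenerated g (· < 0) r (g r) j z → ∀ y ∈ g (-q), ⁅y, z⁆ = 0 := by
    intro j z hz y hy
    induction hz with
    | base x hx => exact hhigh r hqr y hy x hx
    | zero j => exact lie_zero y
    | add j a b _ _ ha hb => rw [lie_add, ha, hb, add_zero]
    | smul j c a _ ha => rw [lie_smul, ha, smul_zero]
    | lie i j hi a x ha _ hx => rw [leibniz_lie, hlow i hi y hy a ha, hx, zero_lie, lie_zero, add_zero]
  let C : ℤ → Submodule F L := fun k =>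
    { carrier := {x | x ∈ g k ∧ ∀ j, ∀ z ∈ K j, ⁅x, z⁆ = 0}
      zero_mem' := ⟨zero_mem _, fun _ z _ => zero_lie z⟩
      add_mem' := fun {a b} ha hb => ⟨add_mem ha.1 hb.1, fun j z hz => by
        rw [add_lie, ha.2 j z hz, hb.2 j z hz, add_zero]⟩
      smul_mem' := fun c a ha => ⟨Submodule.smul_mem _ _ ha.1, fun j z hz => by
        rw [smul_lie, ha.2 j z hz, smul_zero]⟩ }
  have hC : IsGradedIdeal g C :=
    { le := fun j x hx => hx.1
      lie_mem := fun i j a ha x hx => ⟨hgraded _ _ a ha x hx.1, fun k z hz => by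
        rw [lie_lie, hx.2 k z hz, hx.2 _ _ (hK.lie_mem i k a ha z hz), lie_zero, sub_zero]⟩ }
  obtain ⟨y, hy, hy0⟩ := (Submodule.ne_bot_iff _).mp hdepth_ne
  obtain ⟨j, hj, hCj⟩ := hC.exists_nonneg htop hrad (k := -q)
    ((Submodule.ne_bot_iff _).mpr ⟨y, ⟨hy, fun j z hz => hcomm j z hz y hy⟩, hy0⟩)
  obtain ⟨x, hx, hx0⟩ := (Submodule.ne_bot_iff _).mp hCj
  exact hx0 (htrans x (mem_nonnegPart hj hx.1) fun w hw => hx.2 (-1) w (hK1 ▸ hw))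

end GradedLie

/-- In a graded Lie algebra of depth `q` and height `r` satisfying conditions (1.6),
if `q ≤ r` then `⁅g₋q, ⁅g₋q, g_q⁆⁆ ≠ 0`. -/
theorem statement9 {F L : Type*} [Field F] [LieRing L] [LieAlgebra F L]
    [FiniteDimensional F L]
    (hchar2 : ringChar F ≠ 2) (hchar3 : ringChar F ≠ 3)
    (g : ℤ → Submodule F L)
    (hdirect : DirectSum.IsInternal g)
    (hgraded : ∀ i j : ℤ, ∀ x ∈ g i, ∀ y ∈ g j, ⁅x, y⁆ ∈ g (i + j))
    -- depth q and height r
    (q r : ℤ)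
    (hdepth_ne : g (-q) ≠ ⊥)
    (hdepth : ∀ j : ℤ, q < j → g (-j) = ⊥)
    (hheight_ne : g r ≠ ⊥)
    (hheight : ∀ j : ℤ, r < j → g j = ⊥)
    -- irreducibility
    (hirr_ne : g (-1) ≠ ⊥)
    (hirr : ∀ W : Submodule F L, W ≤ g (-1) →
      (∀ x ∈ g 0, ∀ w ∈ W, ⁅x, w⁆ ∈ W) → W = ⊥ ∨ W = g (-1))
    -- transitivity
    (htrans : ∀ x ∈ nonnegPart g, (∀ y ∈ g (-1), ⁅x, y⁆ = 0) → x = 0)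
    -- the only Lie ideal contained in the negative part is zero
    (hrad : ∀ J : Submodule F L, (∀ x : L, ∀ y ∈ J, ⁅x, y⁆ ∈ J) →
      J ≤ negPart g → J = ⊥)
    -- g₋ᵢ = ⁅g₋₁, g₋₍ᵢ₋₁₎⁆ for all i ≥ 2
    (hgen : ∀ i : ℤ, 2 ≤ i → g (-i) = bracketSpan (g (-1)) (g (-(i - 1))))
    (hqr : q ≤ r) :
    ∃ y ∈ g (-q), ∃ y' ∈ g (-q), ∃ z ∈ g q, ⁅y', ⁅y, z⁆⁆ ≠ 0 := by
  have htop := hdirect.submodule_iSup_eq_top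
  have hq : 1 ≤ q := by
    by_contra! hq
    exact hirr_ne (hdepth 1 hq)
  by_contra! h
  have hext := fun (k : ℤ) (hk : -q < k) (x : L) (hx : x ∈ g k) =>
    eq_zero_of_lie_neg_one_eq_zero htop hgraded hrad hirr htrans hgen hq hdepth_ne hk hx
  have hsandwich := lie_lie_eq_zero_of_lowest hgraded hdepth hext h
  obtain ⟨y, hy, z, hz, hne⟩ := exists_lie_ne_zero htop hgraded hdepth_ne hdepth hheight_ne hheight
    hirr htrans hrad hqr
  exact hne (lie_eq_zero_of_lie_lie_eq_zero hchar2 hgraded hdepth hirr_ne hirr htrans hsandwich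
    y hy z hz)
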